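/- Let LC_n denote the length of the longest common subsequence of m independent uniformly random sequences of length n over a k-letter alphabet (k ≥ 2, m ≥ 2), and let V_k ∈ [1/k,1) be the unique solution of H_k(θ)=1 where H_k(θ) = k^{θ/m-1}(k-1)^{1-θ}/(θ^θ(1-θ)^{1-θ}). Then limsup_{n→∞} E[LC_n]/n ≤ V_k. -/

import Mathlib

open Filter

/-- The length of the longest common subsequence of `m` lists. -/
noncomputable def LC {α : Type*} {m : ℕ} (as : Fin m → List α) : ℕ :=
  sSup {l | ∃ c : List α, c.length = l ∧ ∀ i, c.Sublist (as i)}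

noncomputable def Hk (k m : ℕ) (θ : ℝ) : ℝ :=
  (k : ℝ) ^ (θ / m - 1) * ((k : ℝ) - 1) ^ (1 - θ) / (θ ^ θ * (1 - θ) ^ (1 - θ))

/-- The expected LCS length of `m` independent uniform sequences of length `n`
over a `k`-letter alphabet. -/
noncomputable def expLC (k m n : ℕ) : ℝ :=
  (∑ a : Fin m → Fin n → Fin k, (LC (fun i => List.ofFn (a i)) : ℝ)) / (k : ℝ) ^ (m * n)

/-- number of words of length `n` containing `c` as a subsequence -/
noncomputable def supN (k n : ℕ) (c : List (Fin k)) : ℕ := by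
  classical
  exact (Finset.univ.filter (fun f : Fin n → Fin k => c.Sublist (List.ofFn f))).card

lemma supN_succ (k n : ℕ) (c : Fin k) (cs : List (Fin k)) :
    (supN k (n + 1) (c :: cs) : ℝ) ≤ supN k n cs + ((k : ℝ) - 1) * supN k n (c :: cs) := by
  classical
  have h1 : (supN k (n + 1) (c :: cs) : ℝ)
      = ∑ x : Fin k, ∑ g : Fin n → Fin k,
        if (c :: cs).Sublist (x :: List.ofFn g) then (1 : ℝ) else 0 := by
    unfold supN
    rw [Finset.card_filter]
    push_cast
    rw [← (Fin.consEquiv (fun _ : Fin (n + 1) => Fin k)).sum_comp, Fintype.sum_prod_type]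
    refine Finset.sum_congr rfl fun x _ => Finset.sum_congr rfl fun g _ => ?_
    have : List.ofFn ((Fin.consEquiv (fun _ : Fin (n + 1) => Fin k)) (x, g)) = x :: List.ofFn g := by
      rw [List.ofFn_succ]
      simp [Fin.consEquiv]
    rw [this]
  have hN : ∀ d : List (Fin k), (supN k n d : ℝ)
      = ∑ g : Fin n → Fin k, if d.Sublist (List.ofFn g) then (1 : ℝ) else 0 := by
    intro d
    unfold supN
    rw [Finset.card_filter]
    push_cast
    rfl
  have h2 : ∀ x : Fin k, (∑ g : Fin n → Fin k,
        if (c :: cs).Sublist (x :: List.ofFn g) then (1 : ℝ) else 0)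
        = if x = c then (supN k n cs : ℝ) else supN k n (c :: cs) := by
    intro x
    split_ifs with h
    · subst h
      rw [hN]
      simp only [List.cons_sublist_cons]
    · rw [hN]
      refine Finset.sum_congr rfl fun g _ => ?_
      have : (c :: cs).Sublist (x :: List.ofFn g) ↔ (c :: cs).Sublist (List.ofFn g) := by
        rw [List.sublist_cons_iff]
        constructor
        · rintro (h' | ⟨r, hr, _⟩)
          · exact h'
          · simp at hr
            exact absurd hr.1.symm h
        · exact Or.inl
      simp only [this]
  rw [h1, Finset.sum_congr rfl fun x _ => h2 x, Finset.sum_ite]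
  have e1 : (Finset.univ.filter (fun x : Fin k => x = c)).card = 1 := by
    rw [Finset.filter_eq' Finset.univ c]; simp
  have e2 : ((Finset.univ.filter (fun x : Fin k => ¬ x = c)).card : ℝ) = (k : ℝ) - 1 := by
    have := Finset.card_filter_add_card_filter_not (s := (Finset.univ : Finset (Fin k)))
      (fun x : Fin k => x = c)
    rw [e1] at this
    simp only [Finset.card_univ, Fintype.card_fin] at this
    have h3 : ((1 + (Finset.univ.filter (fun x : Fin k => ¬ x = c)).card : ℕ) : ℝ) = k := by
      exact_mod_cast this
    push_cast at h3
    linarith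
  rw [Finset.sum_const, Finset.sum_const, e1, nsmul_eq_mul, nsmul_eq_mul, e2]
  simp

lemma supN_le (k : ℕ) (hk : 2 ≤ k) (x : ℝ) (hx : 1 ≤ x) (n : ℕ) :
    ∀ c : List (Fin k), (supN k n c : ℝ) * x ^ c.length ≤ (x + k - 1) ^ n := by
  have hk' : (2 : ℝ) ≤ k := by exact_mod_cast hk
  induction n with
  | zero =>
    intro c
    cases c with
    | nil => simp [supN]
    | cons c cs => simp [supN]
  | succ n ih =>
    intro c
    cases c with
    | nil =>
      simp only [supN, List.nil_sublist, Finset.filter_true, Finset.card_univ, List.length_nil,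
        pow_zero, mul_one, Fintype.card_fun, Fintype.card_fin]
      push_cast
      exact pow_le_pow_left₀ (by linarith) (by linarith) _
    | cons c cs =>
      have h1 := ih cs
      have h2 := ih (c :: cs)
      have h3 := supN_succ k n c cs
      have hxp : 0 < x ^ (c :: cs).length := by positivity
      calc _ ≤ (supN k n cs + ((k : ℝ) - 1) * supN k n (c :: cs)) * x ^ (c :: cs).length :=
            mul_le_mul_of_nonneg_right h3 hxp.le
        _ = x * (supN k n cs * x ^ cs.length)
            + ((k : ℝ) - 1) * (supN k n (c :: cs) * x ^ (c :: cs).length) := by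
            simp only [List.length_cons]; ring
        _ ≤ x * (x + k - 1) ^ n + ((k : ℝ) - 1) * (x + k - 1) ^ n := by
            gcongr
            linarith
        _ = _ := by ring

lemma LC_set_bdd {k m n : ℕ} (hm : 2 ≤ m) (a : Fin m → Fin n → Fin k) :
    ∀ l ∈ {l | ∃ c : List (Fin k), c.length = l ∧ ∀ i, c.Sublist (List.ofFn (a i))}, l ≤ n := by
  rintro l ⟨c, rfl, h⟩
  simpa using (h ⟨0, by omega⟩).length_le

lemma LC_mem {k m n : ℕ} (hm : 2 ≤ m) (a : Fin m → Fin n → Fin k) :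
    ∃ c : List (Fin k), c.length = LC (fun i => List.ofFn (a i)) ∧
      ∀ i, c.Sublist (List.ofFn (a i)) :=
  Nat.sSup_mem (s := {l | ∃ c : List (Fin k), c.length = l ∧ ∀ i, c.Sublist (List.ofFn (a i))})
    ⟨0, [], rfl, fun i => List.nil_sublist _⟩ ⟨n, LC_set_bdd hm a⟩

lemma LC_le {k m n : ℕ} (hm : 2 ≤ m) (a : Fin m → Fin n → Fin k) :
    LC (fun i => List.ofFn (a i)) ≤ n := by
  obtain ⟨c, hc, h⟩ := LC_mem hm a
  exact LC_set_bdd hm a _ ⟨c, hc, h⟩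

lemma count_le (k m n l : ℕ) (hk : 2 ≤ k) (hm : 2 ≤ m) (x : ℝ) (hx : 1 ≤ x) :
    ((Finset.univ.filter (fun a : Fin m → Fin n → Fin k =>
      l ≤ LC (fun i => List.ofFn (a i)))).card : ℝ)
      ≤ (k : ℝ) ^ l * ((x + k - 1) ^ n / x ^ l) ^ m := by
  classical
  have hsub : Finset.univ.filter (fun a : Fin m → Fin n → Fin k =>
      l ≤ LC (fun i => List.ofFn (a i))) ⊆
      Finset.univ.biUnion (fun c : Fin l → Fin k =>
        Fintype.piFinset (fun _ : Fin m =>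
          Finset.univ.filter (fun f : Fin n → Fin k => (List.ofFn c).Sublist (List.ofFn f)))) := by
    intro a ha
    simp only [Finset.mem_filter, Finset.mem_univ, true_and] at ha
    obtain ⟨c, hc, h⟩ := LC_mem hm a
    have hlen : (c.take l).length = l := by simp; omega
    simp only [Finset.mem_biUnion, Finset.mem_univ, true_and, Fintype.mem_piFinset,
      Finset.mem_filter]
    refine ⟨fun i => (c.take l).get (i.cast hlen.symm), fun i => ?_⟩
    have : List.ofFn (fun i : Fin l => (c.take l).get (i.cast hlen.symm)) = c.take l := by
      apply List.ext_get
      · simp; omega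
      · intro j h1 h2
        simp
    rw [this]
    exact (List.take_sublist l c).trans (h i)
  have h1 := (Finset.card_le_card hsub).trans Finset.card_biUnion_le
  have h2 : ∀ c : Fin l → Fin k, (((Fintype.piFinset (fun _ : Fin m =>
          Finset.univ.filter (fun f : Fin n → Fin k =>
            (List.ofFn c).Sublist (List.ofFn f)))).card : ℕ) : ℝ)
          ≤ ((x + k - 1) ^ n / x ^ l) ^ m := by
    intro c
    rw [Fintype.card_piFinset]
    simp only [Finset.prod_const, Finset.card_univ, Fintype.card_fin]
    push_cast
    apply pow_le_pow_left₀ (by positivity)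
    rw [le_div_iff₀ (by positivity)]
    have := supN_le k hk x hx n (List.ofFn c)
    rw [List.length_ofFn] at this
    unfold supN at this
    convert this using 3
  calc _ ≤ _ := (Nat.cast_le (α := ℝ)).2 h1
    _ ≤ ∑ c : Fin l → Fin k, ((x + k - 1) ^ n / x ^ l) ^ m := by
      push_cast
      exact Finset.sum_le_sum fun c _ => h2 c
    _ = _ := by simp

lemma expLC_le (k m n l : ℕ) (hk : 2 ≤ k) (hm : 2 ≤ m) (x : ℝ) (hx : 1 ≤ x) (t : ℝ)
    (ht : 0 ≤ t) (hl : l = ⌈t * n⌉₊) :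
    expLC k m n ≤ t * n + n * ((k / x ^ m) ^ l * (((x + k - 1) / k) ^ m) ^ n) := by
  classical
  have hk' : (2 : ℝ) ≤ k := by exact_mod_cast hk
  unfold expLC
  have hkp : (0 : ℝ) < (k : ℝ) ^ (m * n) := by positivity
  rw [div_le_iff₀ hkp]
  have hpt : ∀ a : Fin m → Fin n → Fin k, (LC (fun i => List.ofFn (a i)) : ℝ) ≤
      t * n + n * (if l ≤ LC (fun i => List.ofFn (a i)) then 1 else 0) := by
    intro a
    split_ifs with h
    · have : (LC (fun i => List.ofFn (a i)) : ℝ) ≤ n := by exact_mod_cast LC_le hm a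
      have : 0 ≤ t * n := by positivity
      linarith
    · rw [hl, not_le, Nat.lt_ceil] at h
      linarith
  have hc := count_le k m n l hk hm x hx
  calc _ ≤ ∑ a : Fin m → Fin n → Fin k, (t * n + n *
        (if l ≤ LC (fun i => List.ofFn (a i)) then (1 : ℝ) else 0)) :=
        Finset.sum_le_sum fun a _ => hpt a
    _ = (k : ℝ) ^ (m * n) * (t * n) + n * ((Finset.univ.filter (fun a : Fin m → Fin n → Fin k =>
      l ≤ LC (fun i => List.ofFn (a i)))).card : ℝ) := by
        rw [Finset.sum_add_distrib, Finset.sum_const, ← Finset.mul_sum, Finset.sum_boole]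
        simp [← pow_mul, mul_comm n m]
    _ ≤ (k : ℝ) ^ (m * n) * (t * n) + n * ((k : ℝ) ^ l * ((x + k - 1) ^ n / x ^ l) ^ m) := by
        gcongr
    _ = _ := by
        have : (k : ℝ) ≠ 0 := by positivity
        have : x ≠ 0 := by positivity
        simp only [div_pow, ← pow_mul, mul_comm n m, mul_comm l m]
        field_simp

lemma Hk_identity (k m : ℕ) (hk : 2 ≤ k) (hm : 2 ≤ m) (t : ℝ) (h0 : 0 < t) (h1 : t < 1)
    (x : ℝ) (hx : x = t * (k - 1) / (1 - t)) :
    ((k : ℝ) / x ^ m) ^ t * ((x + k - 1) / k) ^ m = Hk k m t ^ m := by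
  have hk' : (2 : ℝ) ≤ k := by exact_mod_cast hk
  have hm' : (2 : ℝ) ≤ m := by exact_mod_cast hm
  have hk1 : (0 : ℝ) < k - 1 := by linarith
  have ht1 : 0 < 1 - t := by linarith
  have hk0 : (0 : ℝ) < k := by linarith
  have hx0 : 0 < x := by rw [hx]; positivity
  have hxk : x + k - 1 = (k - 1) / (1 - t) := by rw [hx]; field_simp; ring
  rw [hxk]
  have hH : 0 < Hk k m t := by unfold Hk; positivity
  apply Real.log_injOn_pos
  · simp only [Set.mem_Ioi]; positivity
  · simp only [Set.mem_Ioi]; positivity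
  have lx : Real.log x = Real.log t + Real.log (k - 1) - Real.log (1 - t) := by
    rw [hx, Real.log_div (by positivity) (by positivity), Real.log_mul (by positivity) (by positivity)]
  rw [Real.log_mul (by positivity) (by positivity), Real.log_rpow (by positivity),
    Real.log_div (by positivity) (by positivity), Real.log_pow, Real.log_pow, Real.log_pow, lx,
    Real.log_div (by positivity) (by positivity), Real.log_div (by positivity) (by positivity)]
  unfold Hk
  rw [Real.log_div (by positivity) (by positivity), Real.log_mul (by positivity) (by positivity),
    Real.log_mul (by positivity) (by positivity), Real.log_rpow hk0, Real.log_rpow hk1,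
    Real.log_rpow h0, Real.log_rpow ht1]
  field_simp
  ring

lemma self_rpow_eq (x : ℝ) (hx : 0 ≤ x) : x ^ x = Real.exp (x * Real.log x) := by
  rcases hx.eq_or_lt with rfl | h
  · simp
  · rw [Real.rpow_def_of_pos h, mul_comm]

lemma Hk_cont (k m : ℕ) (hk : 2 ≤ k) : ContinuousOn (Hk k m) (Set.Icc 0 1) := by
  have hk' : (2 : ℝ) ≤ k := by exact_mod_cast hk
  have hk1 : (0 : ℝ) < k - 1 := by linarith
  have hk0 : (0 : ℝ) < k := by linarith
  have hc : Continuous (fun θ : ℝ => Real.exp (Real.log k * (θ / m - 1)) *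
      Real.exp (Real.log ((k : ℝ) - 1) * (1 - θ)) /
      (Real.exp (θ * Real.log θ) * Real.exp ((1 - θ) * Real.log (1 - θ)))) := by
    have c1 : Continuous (fun θ : ℝ => Real.exp (θ * Real.log θ)) :=
      Real.continuous_exp.comp Real.continuous_mul_log
    have c2 : Continuous (fun θ : ℝ => Real.exp ((1 - θ) * Real.log (1 - θ))) :=
      c1.comp (continuous_const.sub continuous_id)
    refine Continuous.div ?_ (c1.mul c2) (fun θ => by positivity)
    fun_prop
  refine hc.continuousOn.congr fun θ hθ => ?_
  unfold Hk
  rw [self_rpow_eq θ hθ.1, self_rpow_eq (1 - θ) (by linarith [hθ.2]),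
    Real.rpow_def_of_pos hk0, Real.rpow_def_of_pos hk1]

lemma Hk_one (k m : ℕ) (hk : 2 ≤ k) (hm : 2 ≤ m) : Hk k m 1 < 1 := by
  have hk' : (2 : ℝ) ≤ k := by exact_mod_cast hk
  have hm' : (2 : ℝ) ≤ m := by exact_mod_cast hm
  unfold Hk
  simp only [sub_self, Real.rpow_zero, Real.one_rpow, mul_one, div_one]
  apply Real.rpow_lt_one_of_one_lt_of_neg (by linarith)
  have : 1 / (m : ℝ) < 1 := by rw [div_lt_one (by linarith)]; linarith
  linarith

theorem stmt13 (k m : ℕ) (hk : 2 ≤ k) (hm : 2 ≤ m) (V : ℝ)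
    (hV : V ∈ Set.Ico (1 / (k : ℝ)) 1) (hV1 : Hk k m V = 1)
    (hVuniq : ∀ θ ∈ Set.Ico (1 / (k : ℝ)) 1, Hk k m θ = 1 → θ = V) :
    limsup (fun n : ℕ => expLC k m n / n) atTop ≤ V := by
  have hk' : (2 : ℝ) ≤ k := by exact_mod_cast hk
  have hm' : (2 : ℝ) ≤ m := by exact_mod_cast hm
  have hk0 : (0 : ℝ) < k := by linarith
  have hVpos : 0 < V := lt_of_lt_of_le (by positivity) hV.1
  by_contra hcon
  rw [not_le] at hcon
  obtain ⟨t, ht1, ht2⟩ := exists_between (lt_min hcon hV.2)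
  obtain ⟨htL, htlt⟩ := lt_min_iff.1 ht2
  have ht0 : 0 < t := hVpos.trans ht1
  have hH : Hk k m t < 1 := by
    by_contra h
    rw [not_lt] at h
    have hiv := intermediate_value_Icc' htlt.le
      ((Hk_cont k m hk).mono (Set.Icc_subset_Icc_left ht0.le))
    obtain ⟨s, hs, hs1⟩ := hiv ⟨(Hk_one k m hk hm).le, h⟩
    have hsne : s ≠ 1 := by
      rintro rfl
      linarith [Hk_one k m hk hm]
    have := hVuniq s ⟨by linarith [hV.1, hs.1], lt_of_le_of_ne hs.2 hsne⟩ hs1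
    linarith [hs.1]
  have hHpos : 0 < Hk k m t := by
    unfold Hk
    have : (0 : ℝ) < k - 1 := by linarith
    have : 0 < 1 - t := by linarith
    positivity
  set x : ℝ := t * (k - 1) / (1 - t) with hx
  have hx1 : 1 ≤ x := by
    rw [hx, le_div_iff₀ (by linarith)]
    have := (div_le_iff₀ hk0).1 (hV.1.trans ht1.le)
    linarith
  have hid := Hk_identity k m hk hm t ht0 htlt x hx
  set y : ℝ := (k : ℝ) / x ^ m with hy
  have hy0 : 0 < y := by positivity
  set B : ℝ := ((x + k - 1) / k) ^ m with hB
  have hB0 : 0 ≤ B := by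
    have : 0 ≤ x + k - 1 := by linarith
    positivity
  have hr : y ^ t * B < 1 := by
    rw [hid]
    exact pow_lt_one₀ hHpos.le hH (by omega)
  have hr0 : 0 ≤ y ^ t * B := by positivity
  have hbound : ∀ᶠ n : ℕ in atTop, expLC k m n / n ≤ t + max 1 y * (y ^ t * B) ^ n := by
    filter_upwards [eventually_ge_atTop 1] with n hn
    have hn' : (0 : ℝ) < n := by exact_mod_cast hn
    rw [div_le_iff₀ hn']
    have h := expLC_le k m n _ hk hm x hx1 t ht0.le rfl
    rw [← hy, ← hB] at h
    have hyl : y ^ ⌈t * n⌉₊ ≤ max 1 y * (y ^ t) ^ n := by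
      have e : y ^ ⌈t * n⌉₊ = y ^ ((⌈t * n⌉₊ : ℝ) - t * n) * (y ^ t) ^ n := by
        rw [← Real.rpow_natCast (y ^ t), ← Real.rpow_mul hy0.le, ← Real.rpow_add hy0,
          ← Real.rpow_natCast]
        congr 1
        ring
      rw [e]
      gcongr
      have g1 : 0 ≤ (⌈t * n⌉₊ : ℝ) - t * n := by linarith [Nat.le_ceil (t * n)]
      have g2 : (⌈t * n⌉₊ : ℝ) - t * n ≤ 1 := by
        linarith [Nat.ceil_lt_add_one (show 0 ≤ t * n by positivity)]
      rcases le_total y 1 with h1 | h1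
      · exact (Real.rpow_le_one hy0.le h1 g1).trans (le_max_left _ _)
      · refine le_trans ?_ (le_max_right _ _)
        simpa using Real.rpow_le_rpow_of_exponent_le h1 g2
    calc expLC k m n ≤ _ := h
      _ ≤ t * n + n * ((max 1 y * (y ^ t) ^ n) * B ^ n) := by gcongr
      _ = _ := by rw [mul_pow]; ring
  have htend : Tendsto (fun n : ℕ => t + max 1 y * (y ^ t * B) ^ n) atTop (nhds t) := by
    have := ((tendsto_pow_atTop_nhds_zero_of_lt_one hr0 hr).const_mul (max 1 y)).const_add t
    simpa using this
  have hnn : ∀ n : ℕ, 0 ≤ expLC k m n / n := by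
    intro n
    unfold expLC
    positivity
  have hle := limsup_le_limsup hbound
    (isCoboundedUnder_le_of_le atTop hnn) htend.isBoundedUnder_le
  rw [htend.limsup_eq] at hle
  linarith
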